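/- Assume the adjustment family Z satisfies positivity and is history-nested, i.e., σ(Z_0 ∪ … ∪ Z_{k−1} ∪ {A_0,…,A_{k−1}}) ⊆ σ(Z_k) for every k = 1,…,p. Then each term of the influence function has mean zero: E[ I_{ā_p}(Ā_p)·(Y − b_{a_p}(Z)) / λ_{ā_p}(Z̄_p) ] = 0 and E[ I_{ā_{k−1}}(Ā_{k−1})·(b_{a_k}(Z) − b_{a_{k−1}}(Z)) / λ_{ā_{k−1}}(Z̄_{k−1}) ] = 0 for every k = 1,…,p; consequently E[ψ_a(Z)] = 0 and E[ I_{ā_p}(Ā_p)·Y / λ_{ā_p}(Z̄_p) ] = E[b_{a_0}(Z)]. (The influence function used throughout Section 4 is mean-zero, and the IPW and iterated-regression functionals coincide, for history-nested adjustment families.) -/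

import Mathlib

open MeasureTheory ProbabilityTheory

noncomputable section

/-- The σ-algebra generated by a set of real-valued random variables. -/
def genSig {Ω : Type*} (S : Set (Ω → ℝ)) : MeasurableSpace Ω :=
  ⨆ f ∈ S, MeasurableSpace.comap f (inferInstance : MeasurableSpace ℝ)

/-- Indicator `1_{A = a}` of the event that the random variable `A` takes the value `a`. -/
def ind {Ω : Type*} (A : Ω → ℝ) (a : ℝ) : Ω → ℝ := fun ω => if A ω = a then 1 else 0

/-- `I_{ā_{k-1}}(Ā_{k-1}) = ∏_{j<k} 1_{A_j = a_j}` (equal to `1` when `k = 0`). -/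
def indUpto {Ω : Type*} (A : ℕ → Ω → ℝ) (a : ℕ → ℝ) (k : ℕ) : Ω → ℝ :=
  fun ω => ∏ j ∈ Finset.range k, ind (A j) (a j) ω

variable {Ω : Type*} [MeasurableSpace Ω]

/-- Propensity `π_{a_k}(Z_k) = E[1_{A_k = a_k} ∣ σ(Z_k)]`. -/
def propen (μ : Measure Ω) (A : ℕ → Ω → ℝ) (a : ℕ → ℝ) (Z : ℕ → Set (Ω → ℝ)) (k : ℕ) : Ω → ℝ :=
  μ[ind (A k) (a k) | genSig (Z k)]

/-- Cumulative weight `λ_{ā_{k-1}}(Z̄_{k-1}) = ∏_{j<k} π_{a_j}(Z_j)` (equal to `1` when `k = 0`). -/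
def cumWeight (μ : Measure Ω) (A : ℕ → Ω → ℝ) (a : ℕ → ℝ) (Z : ℕ → Set (Ω → ℝ)) (k : ℕ) :
    Ω → ℝ :=
  fun ω => ∏ j ∈ Finset.range k, propen μ A a Z j ω

/-- The adjustment family `Z` satisfies positivity: the propensities are uniformly bounded away
from `0` almost surely, for every time `k = 0, …, p`. -/
def Positivity (μ : Measure Ω) (A : ℕ → Ω → ℝ) (a : ℕ → ℝ) (Z : ℕ → Set (Ω → ℝ)) (p : ℕ) :
    Prop :=
  ∃ c : ℝ, 0 < c ∧ ∀ k ≤ p, ∀ᵐ ω ∂μ, c ≤ propen μ A a Z k ω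

/-- Auxiliary downward recursion: `bAux μ A a Y Z p n` is the iterated regression
`b_{a_{p-n}}(Z)`. -/
def bAux (μ : Measure Ω) (A : ℕ → Ω → ℝ) (a : ℕ → ℝ) (Y : Ω → ℝ) (Z : ℕ → Set (Ω → ℝ))
    (p : ℕ) : ℕ → Ω → ℝ
  | 0 => fun ω =>
      (μ[fun ω' => Y ω' * ind (A p) (a p) ω' | genSig (Z p)]) ω / propen μ A a Z p ω
  | n + 1 => fun ω =>
      (μ[fun ω' => bAux μ A a Y Z p n ω' * ind (A (p - (n + 1))) (a (p - (n + 1))) ω' |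
          genSig (Z (p - (n + 1)))]) ω / propen μ A a Z (p - (n + 1)) ω

/-- Iterated regression `b_{a_k}(Z)`, for `k = 0, …, p`. -/
def breg (μ : Measure Ω) (A : ℕ → Ω → ℝ) (a : ℕ → ℝ) (Y : Ω → ℝ) (Z : ℕ → Set (Ω → ℝ))
    (p k : ℕ) : Ω → ℝ :=
  bAux μ A a Y Z p (p - k)

/-- `b_{a_{k-1}}(Z)` with the convention `b_{a_{-1}}(Z) = E[b_{a_0}(Z)]` (a constant). -/
def bregPrev (μ : Measure Ω) (A : ℕ → Ω → ℝ) (a : ℕ → ℝ) (Y : Ω → ℝ) (Z : ℕ → Set (Ω → ℝ))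
    (p k : ℕ) : Ω → ℝ :=
  if k = 0 then fun _ => ∫ ω, breg μ A a Y Z p 0 ω ∂μ else breg μ A a Y Z p (k - 1)

/-- The influence function `ψ_a(Z)`. -/
def psi (μ : Measure Ω) (A : ℕ → Ω → ℝ) (a : ℕ → ℝ) (Y : Ω → ℝ) (Z : ℕ → Set (Ω → ℝ))
    (p : ℕ) : Ω → ℝ := fun ω =>
  indUpto A a (p + 1) ω * (Y ω - breg μ A a Y Z p p ω) / cumWeight μ A a Z (p + 1) ω +
    ∑ k ∈ Finset.range (p + 1),
      indUpto A a k ω * (breg μ A a Y Z p k ω - bregPrev μ A a Y Z p k ω) /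
        cumWeight μ A a Z k ω

end

section IPW

open scoped ENNReal

lemma memLp_top_mul {Ω : Type*} {mΩ : MeasurableSpace Ω} {μ : Measure Ω} {f g : Ω → ℝ}
    (hf : MemLp f ∞ μ) (hg : MemLp g ∞ μ) : MemLp (fun ω => f ω * g ω) ∞ μ :=
  hg.mul hf

/-- Inverse weighting by `μ[D | m]` can be traded for conditioning on `m`. -/
lemma integral_mul_div_condExp {Ω : Type*} {m mΩ : MeasurableSpace Ω} {μ : Measure Ω}
    [IsProbabilityMeasure μ] (hm : m ≤ mΩ) {W D X : Ω → ℝ}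
    (hWm : StronglyMeasurable[m] W) (hW : MemLp W ∞ μ) (hD : MemLp D ∞ μ)
    (hX : MemLp X ∞ μ) (hinv : MemLp (μ[D | m])⁻¹ ∞ μ) :
    ∫ ω, W ω * (D ω / μ[D | m] ω) * X ω ∂μ =
      ∫ ω, W ω * (μ[fun ω' => X ω' * D ω' | m] ω / μ[D | m] ω) ∂μ := by
  set G : Ω → ℝ := fun ω => W ω * (μ[D | m])⁻¹ ω with hG
  have hGm : StronglyMeasurable[m] G :=
    hWm.mul (stronglyMeasurable_condExp.measurable.inv.stronglyMeasurable)
  have hXD := memLp_top_mul hX hD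
  have hpull := condExp_mul_of_stronglyMeasurable_left hGm
    ((memLp_top_mul (memLp_top_mul hW hinv) hXD).integrable le_top) (hXD.integrable le_top)
  calc ∫ ω, W ω * (D ω / μ[D | m] ω) * X ω ∂μ
      = ∫ ω, (G * fun ω' => X ω' * D ω') ω ∂μ := by
        congr 1 with ω
        simp only [hG, Pi.mul_apply, Pi.inv_apply]
        ring
    _ = ∫ ω, μ[G * fun ω' => X ω' * D ω' | m] ω ∂μ := (integral_condExp hm).symm
    _ = ∫ ω, W ω * (μ[fun ω' => X ω' * D ω' | m] ω / μ[D | m] ω) ∂μ := by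
        refine integral_congr_ae (hpull.trans (.of_forall fun ω => ?_))
        simp only [hG, Pi.mul_apply, Pi.inv_apply]
        ring

lemma measurable_of_mem_genSig {Ω : Type*} {S : Set (Ω → ℝ)} {f : Ω → ℝ} (hf : f ∈ S) :
    Measurable[genSig S] f :=
  Measurable.of_comap_le (le_iSup₂_of_le f hf le_rfl)

lemma genSig_mono {Ω : Type*} {S T : Set (Ω → ℝ)} (h : S ⊆ T) : genSig S ≤ genSig T :=
  biSup_mono fun _ hf => h hf

lemma measurable_ind {Ω : Type*} {m : MeasurableSpace Ω} {B : Ω → ℝ} (hB : Measurable B) (b : ℝ) :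
    Measurable (ind B b) :=
  Measurable.ite (hB (measurableSet_singleton b)) measurable_const measurable_const

lemma memLp_top_ind {Ω : Type*} {mΩ : MeasurableSpace Ω} {μ : Measure Ω} {B : Ω → ℝ}
    (hB : Measurable B) (b : ℝ) : MemLp (ind B b) ∞ μ := by
  refine memLp_top_of_bound (measurable_ind hB b).aestronglyMeasurable 1 (.of_forall fun ω => ?_)
  unfold ind
  split_ifs <;> simp

variable {Ω : Type*} [mΩ : MeasurableSpace Ω]

/-- The inverse probability weight `I_{ā_{k-1}}(Ā_{k-1}) / λ_{ā_{k-1}}(Z̄_{k-1})`. -/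
noncomputable def ipWeight (μ : Measure Ω) (A : ℕ → Ω → ℝ) (a : ℕ → ℝ) (Z : ℕ → Set (Ω → ℝ))
    (k : ℕ) : Ω → ℝ :=
  fun ω => indUpto A a k ω / cumWeight μ A a Z k ω

/-- One step of the iterated regression, `E[X ⬝ 1_{A_k = a_k} ∣ σ(Z_k)] / π_{a_k}(Z_k)`. -/
noncomputable def regStep (μ : Measure Ω) (A : ℕ → Ω → ℝ) (a : ℕ → ℝ) (Z : ℕ → Set (Ω → ℝ))
    (k : ℕ) (X : Ω → ℝ) : Ω → ℝ :=
  fun ω => (μ[fun ω' => X ω' * ind (A k) (a k) ω' | genSig (Z k)]) ω / propen μ A a Z k ω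

variable {P : Measure Ω} {A : ℕ → Ω → ℝ} {a : ℕ → ℝ} {Z : ℕ → Set (Ω → ℝ)} {Y : Ω → ℝ} {p k : ℕ}

lemma ipWeight_zero : ipWeight P A a Z 0 = fun _ => 1 := by
  ext ω
  simp [ipWeight, indUpto, cumWeight]

lemma ipWeight_succ (ω : Ω) : ipWeight P A a Z (k + 1) ω =
    ipWeight P A a Z k ω * (ind (A k) (a k) ω / propen P A a Z k ω) := by
  simp only [ipWeight, indUpto, cumWeight, Finset.prod_range_succ]
  rw [mul_div_mul_comm]

lemma breg_self : breg P A a Y Z p p = regStep P A a Z p Y := by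
  simp only [breg, Nat.sub_self]
  rfl

lemma breg_of_lt (hk : k < p) :
    breg P A a Y Z p k = regStep P A a Z k (breg P A a Y Z p (k + 1)) := by
  obtain ⟨n, rfl⟩ := Nat.exists_eq_add_of_lt hk
  have h₁ : k + n + 1 - k = n + 1 := by omega
  have h₂ : k + n + 1 - (k + 1) = n := by omega
  have h₃ : k + n + 1 - (n + 1) = k := by omega
  simp only [breg, h₁, h₂, bAux, h₃]
  rfl

lemma memLp_top_inv_propen [IsProbabilityMeasure P] (hZle : genSig (Z k) ≤ mΩ) {c : ℝ}
    (hc : 0 < c) (h : ∀ᵐ ω ∂P, c ≤ propen P A a Z k ω) : MemLp (propen P A a Z k)⁻¹ ∞ P := by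
  refine memLp_top_of_bound
    ((stronglyMeasurable_condExp.mono hZle).measurable.inv.aestronglyMeasurable) c⁻¹ ?_
  filter_upwards [h] with ω hω
  rw [Pi.inv_apply, Real.norm_of_nonneg (inv_nonneg.2 (hc.le.trans hω))]
  exact inv_anti₀ hc hω

lemma Positivity.memLp_top_inv_propen [IsProbabilityMeasure P] (hpos : Positivity P A a Z p)
    (hZle : ∀ k, genSig (Z k) ≤ mΩ) (hk : k ≤ p) : MemLp (propen P A a Z k)⁻¹ ∞ P :=
  let ⟨_, hc, h⟩ := hpos
  _root_.memLp_top_inv_propen (hZle k) hc (h k hk)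

lemma memLp_top_ipWeight [IsProbabilityMeasure P] (hA : ∀ k, Measurable (A k))
    (hZle : ∀ k, genSig (Z k) ≤ mΩ) (hpos : Positivity P A a Z p) :
    ∀ k ≤ p + 1, MemLp (ipWeight P A a Z k) ∞ P
  | 0, _ => by
    rw [ipWeight_zero]
    exact memLp_const 1
  | k + 1, hk => by
    have hrec := memLp_top_ipWeight hA hZle hpos k (by omega)
    have hstep := memLp_top_mul hrec (memLp_top_mul (memLp_top_ind (hA k) (a k))
      (hpos.memLp_top_inv_propen hZle (Nat.le_of_succ_le_succ hk)))
    refine hstep.congr_norm (hstep.1.congr (.of_forall fun ω => ?_)) (.of_forall fun ω => ?_) <;>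
      simp only [ipWeight_succ, Pi.inv_apply, div_eq_mul_inv]

lemma memLp_top_regStep [IsProbabilityMeasure P] (hA : ∀ k, Measurable (A k))
    (hZle : ∀ k, genSig (Z k) ≤ mΩ) (hpos : Positivity P A a Z p) (hk : k ≤ p) {X : Ω → ℝ}
    (hX : MemLp X ∞ P) : MemLp (regStep P A a Z k X) ∞ P := by
  have h := memLp_top_mul
    ((memLp_top_mul hX (memLp_top_ind (hA k) (a k))).condExp (m := genSig (Z k)) le_top)
    (hpos.memLp_top_inv_propen hZle hk)
  unfold regStep
  simpa only [div_eq_mul_inv, Pi.inv_apply] using h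

lemma memLp_top_breg [IsProbabilityMeasure P] (hA : ∀ k, Measurable (A k))
    (hZle : ∀ k, genSig (Z k) ≤ mΩ) (hpos : Positivity P A a Z p) (hY : MemLp Y ∞ P)
    (hk : k ≤ p) : MemLp (breg P A a Y Z p k) ∞ P := by
  induction hk using Nat.decreasingInduction with
  | self =>
    rw [breg_self]
    exact memLp_top_regStep hA hZle hpos le_rfl hY
  | of_succ k hk ih =>
    rw [breg_of_lt hk]
    exact memLp_top_regStep hA hZle hpos hk.le ih

/-- History-nestedness makes the weight built from the times before `k` a function of `Z_k`. -/
lemma stronglyMeasurable_ipWeight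
    (hnest : ∀ k, 1 ≤ k → k ≤ p →
      genSig ((⋃ j ∈ Set.Iio k, Z j) ∪ A '' Set.Iio k) ≤ genSig (Z k)) (hk : k ≤ p) :
    StronglyMeasurable[genSig (Z k)] (ipWeight P A a Z k) := by
  have hle (j : ℕ) (hj : j < k) :
      genSig ((⋃ j ∈ Set.Iio k, Z j) ∪ A '' Set.Iio k) ≤ genSig (Z k) :=
    hnest k (Nat.one_le_iff_ne_zero.2 (Nat.ne_zero_of_lt hj)) hk
  refine Measurable.stronglyMeasurable (Measurable.div ?_ ?_)
  · refine Finset.measurable_fun_prod _ fun j hj => measurable_ind ?_ _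
    have hj : j ∈ Set.Iio k := Finset.mem_range.1 hj
    exact (measurable_of_mem_genSig (Or.inr (Set.mem_image_of_mem A hj))).mono (hle j hj) le_rfl
  · refine Finset.measurable_fun_prod _ fun j hj => ?_
    have hj : j ∈ Set.Iio k := Finset.mem_range.1 hj
    refine Measurable.mono (stronglyMeasurable_condExp (m := genSig (Z j))).measurable
      ((genSig_mono ?_).trans (hle j hj)) le_rfl
    exact (Set.subset_biUnion_of_mem (u := Z) hj).trans
      Set.subset_union_left

lemma integral_ipWeight_succ_mul [IsProbabilityMeasure P] (hA : ∀ k, Measurable (A k))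
    (hZle : ∀ k, genSig (Z k) ≤ mΩ) (hpos : Positivity P A a Z p)
    (hnest : ∀ k, 1 ≤ k → k ≤ p →
      genSig ((⋃ j ∈ Set.Iio k, Z j) ∪ A '' Set.Iio k) ≤ genSig (Z k)) (hk : k ≤ p)
    {X : Ω → ℝ} (hX : MemLp X ∞ P) :
    ∫ ω, ipWeight P A a Z (k + 1) ω * X ω ∂P =
      ∫ ω, ipWeight P A a Z k ω * regStep P A a Z k X ω ∂P := by
  simp only [ipWeight_succ]
  exact integral_mul_div_condExp (hZle k) (stronglyMeasurable_ipWeight hnest hk)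
    (memLp_top_ipWeight hA hZle hpos k (by omega)) (memLp_top_ind (hA k) (a k)) hX
    (hpos.memLp_top_inv_propen hZle hk)

lemma stronglyMeasurable_regStep (X : Ω → ℝ) :
    StronglyMeasurable[genSig (Z k)] (regStep P A a Z k X) :=
  (stronglyMeasurable_condExp.measurable.div
    stronglyMeasurable_condExp.measurable).stronglyMeasurable

/-- A regression step fixes the functions of `Z_k`. -/
lemma regStep_of_stronglyMeasurable [IsProbabilityMeasure P] (hA : ∀ k, Measurable (A k))
    (hpos : Positivity P A a Z p) (hk : k ≤ p) {X : Ω → ℝ}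
    (hXm : StronglyMeasurable[genSig (Z k)] X) (hX : MemLp X ∞ P) :
    regStep P A a Z k X =ᵐ[P] X := by
  obtain ⟨c, hc, hpos⟩ := hpos
  have hD := memLp_top_ind (μ := P) (hA k) (a k)
  have hpull : P[fun ω => X ω * ind (A k) (a k) ω | genSig (Z k)] =ᵐ[P]
      X * P[ind (A k) (a k) | genSig (Z k)] :=
    condExp_mul_of_stronglyMeasurable_left hXm
    ((memLp_top_mul hX hD).integrable le_top) (hD.integrable le_top)
  filter_upwards [hpull, hpos k hk] with ω h₁ h₂
  rw [regStep, h₁]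
  exact mul_div_cancel_right₀ _ (hc.trans_le h₂).ne'

lemma integral_ipWeight_succ_mul_regStep [IsProbabilityMeasure P] (hA : ∀ k, Measurable (A k))
    (hZle : ∀ k, genSig (Z k) ≤ mΩ) (hpos : Positivity P A a Z p)
    (hnest : ∀ k, 1 ≤ k → k ≤ p →
      genSig ((⋃ j ∈ Set.Iio k, Z j) ∪ A '' Set.Iio k) ≤ genSig (Z k)) (hk : k ≤ p)
    {X : Ω → ℝ} (hX : MemLp X ∞ P) :
    ∫ ω, ipWeight P A a Z (k + 1) ω * regStep P A a Z k X ω ∂P =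
      ∫ ω, ipWeight P A a Z (k + 1) ω * X ω ∂P := by
  have hR := memLp_top_regStep hA hZle hpos hk hX
  rw [integral_ipWeight_succ_mul hA hZle hpos hnest hk hR,
    integral_ipWeight_succ_mul hA hZle hpos hnest hk hX]
  refine integral_congr_ae ?_
  filter_upwards [regStep_of_stronglyMeasurable hA hpos hk (stronglyMeasurable_regStep X) hR]
    with ω hω
  rw [hω]

/-- The iterated regressions all have the same inverse-probability-weighted mean. -/
lemma integral_ipWeight_mul_breg [IsProbabilityMeasure P] (hA : ∀ k, Measurable (A k))
    (hZle : ∀ k, genSig (Z k) ≤ mΩ) (hpos : Positivity P A a Z p)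
    (hnest : ∀ k, 1 ≤ k → k ≤ p →
      genSig ((⋃ j ∈ Set.Iio k, Z j) ∪ A '' Set.Iio k) ≤ genSig (Z k)) (hY : MemLp Y ∞ P)
    (hk : k ≤ p) :
    ∫ ω, ipWeight P A a Z k ω * breg P A a Y Z p k ω ∂P = ∫ ω, breg P A a Y Z p 0 ω ∂P := by
  induction k with
  | zero => simp [ipWeight_zero]
  | succ k ih =>
    rw [← ih (by omega), breg_of_lt hk]
    exact integral_ipWeight_succ_mul hA hZle hpos hnest (by omega)
      (memLp_top_breg hA hZle hpos hY hk)

/-- Each increment of the weighted iterated regressions has mean zero. -/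
lemma integral_ipWeight_mul_sub_regStep [IsProbabilityMeasure P] (hA : ∀ k, Measurable (A k))
    (hZle : ∀ k, genSig (Z k) ≤ mΩ) (hpos : Positivity P A a Z p)
    (hnest : ∀ k, 1 ≤ k → k ≤ p →
      genSig ((⋃ j ∈ Set.Iio k, Z j) ∪ A '' Set.Iio k) ≤ genSig (Z k)) (hk : k ≤ p)
    {X : Ω → ℝ} (hX : MemLp X ∞ P) :
    ∫ ω, indUpto A a (k + 1) ω * (X ω - regStep P A a Z k X ω) /
      cumWeight P A a Z (k + 1) ω ∂P = 0 := by
  have hW := memLp_top_ipWeight hA hZle hpos (k + 1) (by omega)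
  have hR := memLp_top_regStep hA hZle hpos hk hX
  simp only [mul_div_right_comm]
  change ∫ ω, ipWeight P A a Z (k + 1) ω * (X ω - regStep P A a Z k X ω) ∂P = 0
  simp only [mul_sub]
  exact (integral_sub ((memLp_top_mul hW hX).integrable le_top)
    ((memLp_top_mul hW hR).integrable le_top)).trans
    (sub_eq_zero.2 (integral_ipWeight_succ_mul_regStep hA hZle hpos hnest hk hX).symm)

end IPW

/-- the influence function is mean-zero for history-nested adjustment
families, and the IPW and iterated-regression functionals coincide.  If `Z` satisfies
positivity and `σ(Z_0 ∪ … ∪ Z_(k-1) ∪ {A_0, …, A_(k-1)}) ⊆ σ(Z_k)` for `k = 1, …, p`, then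
every term of `ψ_a(Z)` has mean zero, `E[ψ_a(Z)] = 0`, and
`E[I_(ā_p) ⬝ Y / λ_(ā_p)(Z̄_p)] = E[b_(a_0)(Z)]`. -/
theorem psi_mean_zero_of_nested {Ω : Type*} [mΩ : MeasurableSpace Ω] [StandardBorelSpace Ω]
    (P : Measure Ω) [IsProbabilityMeasure P] (p : ℕ)
    (A : ℕ → Ω → ℝ) (hA : ∀ k, Measurable (A k))
    (hAfin : ∀ k, (Set.range (A k)).Finite)
    (Y : Ω → ℝ) (hYm : Measurable Y) (hYbd : ∃ C : ℝ, ∀ ω, |Y ω| ≤ C)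
    (a : ℕ → ℝ) (ha : ∀ k ≤ p, a k ∈ Set.range (A k))
    (Z : ℕ → Set (Ω → ℝ)) (hZle : ∀ k, genSig (Z k) ≤ mΩ)
    (hZpos : Positivity P A a Z p)
    (hnest : ∀ k, 1 ≤ k → k ≤ p →
      genSig ((⋃ j ∈ Set.Iio k, Z j) ∪ A '' Set.Iio k) ≤ genSig (Z k)) :
    (∫ ω, indUpto A a (p + 1) ω * (Y ω - breg P A a Y Z p p ω) /
        cumWeight P A a Z (p + 1) ω ∂P = 0) ∧
    (∀ k, 1 ≤ k → k ≤ p →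
      ∫ ω, indUpto A a k ω * (breg P A a Y Z p k ω - breg P A a Y Z p (k - 1) ω) /
          cumWeight P A a Z k ω ∂P = 0) ∧
    (∫ ω, psi P A a Y Z p ω ∂P = 0) ∧
    (∫ ω, indUpto A a (p + 1) ω * Y ω / cumWeight P A a Z (p + 1) ω ∂P =
      ∫ ω, breg P A a Y Z p 0 ω ∂P) := by
  have hY : MemLp Y ⊤ P := by
    obtain ⟨C, hC⟩ := hYbd
    exact memLp_top_of_bound hYm.aestronglyMeasurable C (.of_forall hC)
  have hb (k : ℕ) (hk : k ≤ p) := memLp_top_breg hA hZle hZpos hY hk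
  have hW := memLp_top_ipWeight hA hZle hZpos
  have hlast : ∫ ω, indUpto A a (p + 1) ω * (Y ω - breg P A a Y Z p p ω) /
      cumWeight P A a Z (p + 1) ω ∂P = 0 := by
    rw [breg_self]
    exact integral_ipWeight_mul_sub_regStep hA hZle hZpos hnest le_rfl hY
  have hmid (k : ℕ) (hk₁ : 1 ≤ k) (hk : k ≤ p) :
      ∫ ω, indUpto A a k ω * (breg P A a Y Z p k ω - breg P A a Y Z p (k - 1) ω) /
        cumWeight P A a Z k ω ∂P = 0 := by
    obtain ⟨k, rfl⟩ := Nat.exists_eq_add_of_le' hk₁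
    rw [Nat.add_sub_cancel, breg_of_lt hk]
    exact integral_ipWeight_mul_sub_regStep hA hZle hZpos hnest (by omega) (hb _ hk)
  refine ⟨hlast, hmid, ?_, ?_⟩
  · have hprev (k : ℕ) (hk : k ≤ p) : MemLp (bregPrev P A a Y Z p k) ⊤ P := by
      unfold bregPrev
      split_ifs with h
      · exact memLp_const _
      · exact hb _ (by omega)
    have hint (k : ℕ) (hk : k ∈ Finset.range (p + 1)) :
        Integrable (fun ω => indUpto A a k ω *
          (breg P A a Y Z p k ω - bregPrev P A a Y Z p k ω) / cumWeight P A a Z k ω) P := by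
      have hk := Finset.mem_range_succ_iff.1 hk
      simp only [mul_div_right_comm]
      exact (memLp_top_mul (hW k (by omega)) ((hb k hk).sub (hprev k hk))).integrable le_top
    have hint_last : Integrable (fun ω => indUpto A a (p + 1) ω *
        (Y ω - breg P A a Y Z p p ω) / cumWeight P A a Z (p + 1) ω) P := by
      simp only [mul_div_right_comm]
      exact (memLp_top_mul (hW _ le_rfl) (hY.sub (hb p le_rfl))).integrable le_top
    unfold psi
    rw [integral_add hint_last (integrable_finsetSum _ hint), hlast,
      integral_finsetSum _ hint, zero_add]
    refine Finset.sum_eq_zero fun k hk => ?_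
    rcases Nat.eq_zero_or_pos k with rfl | hk₀
    · have := integral_sub ((hb 0 p.zero_le).integrable le_top)
        (integrable_const (∫ ω, breg P A a Y Z p 0 ω ∂P))
      simpa [bregPrev, indUpto, cumWeight] using this
    · simpa only [bregPrev, if_neg hk₀.ne'] using hmid k hk₀ (Finset.mem_range_succ_iff.1 hk)
  · rw [← integral_ipWeight_mul_breg hA hZle hZpos hnest hY le_rfl, breg_self]
    simp only [mul_div_right_comm]
    exact integral_ipWeight_succ_mul hA hZle hZpos hnest le_rfl hY
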